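/- The canonical model of SMLKV (with sR_i^c tt' defined to hold iff s→_i t, s→_i t' and ◇_i^c ⊤ ∈ s) is an MLKv^r model, and the system SMLKV is strongly complete with respect to the class of all MLKv^r models for the language MLKv: every SMLKV-consistent set of MLKv formulas is satisfiable at some state of some MLKv^r model. -/

import Mathlib

/-- A Kripke frame with binary relations `rel i` and ternary relations `relc i c`,
together with a valuation; an MLKv^r model is such a frame satisfying `IsMLKv`. -/
structure KFrame where
  S : Type
  rel : ℕ → S → S → Prop
  relc : ℕ → ℕ → S → S → S → Prop
  val : S → ℕ → Prop

/-- The three frame conditions SYM, INCL and ATEUC of MLKv^r models. -/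
def KFrame.IsMLKv (M : KFrame) : Prop :=
  (∀ i c s t u, M.relc i c s t u ↔ M.relc i c s u t) ∧
  (∀ i c s t u, M.relc i c s t u → M.rel i s t ∧ M.rel i s u) ∧
  (∀ i c s t u v, M.relc i c s t u → M.rel i s v → M.relc i c s t v ∨ M.relc i c s u v)

/-- The language MLKv of Plaza-style unconditional "knowing value": the only □_i^c
formula is □_i^c ⊥, represented by the constructor `kvbot i c`. -/
inductive FormV : Type
  | top : FormV
  | atom : ℕ → FormV
  | neg : FormV → FormV
  | and : FormV → FormV → FormV
  | box : ℕ → FormV → FormV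
  | kvbot : ℕ → ℕ → FormV

namespace FormV
def imp (φ ψ : FormV) : FormV := neg (and φ (neg ψ))
def iff (φ ψ : FormV) : FormV := and (imp φ ψ) (imp ψ φ)
def dia (i : ℕ) (φ : FormV) : FormV := neg (box i (neg φ))
/-- ◇_i^c ⊤ abbreviates ¬□_i^c ⊥. -/
def diactop (i c : ℕ) : FormV := neg (kvbot i c)
end FormV

/-- Satisfaction for MLKv formulas over frames with ternary relations:
`s ⊩ □_i^c ⊥` iff there are no `u,v` with `relc i c s u v`. -/
def satV (M : KFrame) : M.S → FormV → Prop
  | _, FormV.top => True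
  | s, FormV.atom p => M.val s p
  | s, FormV.neg φ => ¬ satV M s φ
  | s, FormV.and φ ψ => satV M s φ ∧ satV M s ψ
  | s, FormV.box i φ => ∀ t, M.rel i s t → satV M t φ
  | s, FormV.kvbot i c => ∀ t u, ¬ M.relc i c s t u

/-- Uniform substitution of `χ` for the atom `p`. -/
def FormV.subst (p : ℕ) (χ : FormV) : FormV → FormV
  | .top => .top
  | .atom q => if q = p then χ else .atom q
  | .neg φ => .neg (FormV.subst p χ φ)
  | .and φ ψ => .and (FormV.subst p χ φ) (FormV.subst p χ ψ)
  | .box i φ => .box i (FormV.subst p χ φ)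
  | .kvbot i c => .kvbot i c

/-- `ReplV ψ χ φ φ'`: `φ'` is obtained from `φ` by replacing some occurrences of `ψ` by `χ`. -/
inductive ReplV (ψ χ : FormV) : FormV → FormV → Prop
  | base : ReplV ψ χ ψ χ
  | refl (φ : FormV) : ReplV ψ χ φ φ
  | neg {φ φ'} : ReplV ψ χ φ φ' → ReplV ψ χ (.neg φ) (.neg φ')
  | and {φ₁ φ₁' φ₂ φ₂'} : ReplV ψ χ φ₁ φ₁' → ReplV ψ χ φ₂ φ₂' →
      ReplV ψ χ (.and φ₁ φ₂) (.and φ₁' φ₂')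
  | box (i) {φ φ'} : ReplV ψ χ φ φ' → ReplV ψ χ (.box i φ) (.box i φ')

/-- `φ` is an instance of a propositional tautology. -/
def TautV (φ : FormV) : Prop :=
  ∀ v : FormV → Bool, v .top = true → (∀ ψ, v (.neg ψ) = !v ψ) →
    (∀ ψ χ, v (.and ψ χ) = (v ψ && v χ)) → v φ = true

/-- The proof system SMLKV: TAUT, DISTK, INCLT: ◇_i^c ⊤ → ◇_i ⊤, with rules MP,
necessitation for □_i, uniform substitution, and replacement of equivalents. -/
inductive ProvV : FormV → Prop
  | taut {φ} : TautV φ → ProvV φ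
  | distK (i : ℕ) (φ ψ : FormV) :
      ProvV (.imp (.box i (.imp φ ψ)) (.imp (.box i φ) (.box i ψ)))
  | inclT (i c : ℕ) : ProvV (.imp (FormV.diactop i c) (.dia i .top))
  | mp {φ ψ} : ProvV (.imp φ ψ) → ProvV φ → ProvV ψ
  | necK (i : ℕ) {φ} : ProvV φ → ProvV (.box i φ)
  | subst (p : ℕ) (χ : FormV) {φ} : ProvV φ → ProvV (FormV.subst p χ φ)
  | re {ψ χ φ φ'} : ProvV (.iff ψ χ) → ReplV ψ χ φ φ' → ProvV (.iff φ φ')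

/-- Conjunction of a list of MLKv formulas. -/
def conjV (L : List FormV) : FormV := L.foldr FormV.and FormV.top

/-- `φ` is derivable from `Γ` in SMLKV. -/
def ProvFromV (Γ : Set FormV) (φ : FormV) : Prop :=
  ∃ L : List FormV, (∀ ψ ∈ L, ψ ∈ Γ) ∧ ProvV (.imp (conjV L) φ)

/-- `Γ` is SMLKV-consistent. -/
def ConsistentV (Γ : Set FormV) : Prop :=
  ¬ ∃ L : List FormV, (∀ ψ ∈ L, ψ ∈ Γ) ∧ ProvV (.imp (conjV L) (.neg .top))

/-- `s` is a maximal SMLKV-consistent set. -/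
def MCSV (s : Set FormV) : Prop :=
  ConsistentV s ∧ ∀ φ ∉ s, ¬ ConsistentV (insert φ s)

/-- Canonical binary relation of SMLKV. -/
def canRelV (i : ℕ) (s t : Set FormV) : Prop := ∀ φ, FormV.box i φ ∈ s → φ ∈ t

/-- The canonical model of SMLKV, with `s R_i^c t t'` iff `s →_i t`, `s →_i t'` and
`◇_i^c ⊤ ∈ s`. -/
def canModelV : KFrame where
  S := {s : Set FormV // MCSV s}
  rel := fun i s t => canRelV i s.val t.val
  relc := fun i c s t u =>
    canRelV i s.val t.val ∧ canRelV i s.val u.val ∧ FormV.diactop i c ∈ s.val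
  val := fun s p => FormV.atom p ∈ s.val

theorem conjV_eq_true {v : FormV → Bool} (htop : v .top = true)
    (hand : ∀ ψ χ, v (.and ψ χ) = (v ψ && v χ)) (L : List FormV) :
    v (conjV L) = true ↔ ∀ ψ ∈ L, v ψ = true := by
  induction L with
  | nil => simpa [conjV] using htop
  | cons a L ih =>
    have h : v (conjV (a :: L)) = (v a && v (conjV L)) := hand _ _
    simp [h, ih]

theorem imp_eq_true {v : FormV → Bool} (hneg : ∀ ψ, v (.neg ψ) = !v ψ)
    (hand : ∀ ψ χ, v (.and ψ χ) = (v ψ && v χ)) (φ ψ : FormV) :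
    v (.imp φ ψ) = true ↔ (v φ = true → v ψ = true) := by
  cases h : v φ <;> simp [FormV.imp, hneg, hand, h]

/-- A formula that follows truth-functionally from a provable formula is provable. -/
theorem ProvV.of_tautological_consequence {φ ψ : FormV} (hφ : ProvV φ)
    (h : ∀ v : FormV → Bool, v .top = true → (∀ ψ, v (.neg ψ) = !v ψ) →
      (∀ ψ χ, v (.and ψ χ) = (v ψ && v χ)) → v φ = true → v ψ = true) : ProvV ψ :=
  .mp (.taut fun v htop hneg hand =>
    (imp_eq_true hneg hand _ _).2 (h v htop hneg hand)) hφ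

theorem ProvFromV.of_provV {Γ : Set FormV} {φ : FormV} (h : ProvV φ) : ProvFromV Γ φ := by
  refine ⟨[], by simp, h.of_tautological_consequence fun v _ hneg hand hφ => ?_⟩
  rw [imp_eq_true hneg hand]
  exact fun _ => hφ

theorem ProvFromV.of_mem {Γ : Set FormV} {φ : FormV} (h : φ ∈ Γ) : ProvFromV Γ φ := by
  refine ⟨[φ], by simpa using h, .taut fun v htop hneg hand => ?_⟩
  rw [imp_eq_true hneg hand, conjV_eq_true htop hand]
  simp

theorem ProvFromV.mp {Γ : Set FormV} {φ ψ : FormV} (h : ProvFromV Γ (.imp φ ψ))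
    (h' : ProvFromV Γ φ) : ProvFromV Γ ψ := by
  obtain ⟨L, hL, h⟩ := h
  obtain ⟨L', hL', h'⟩ := h'
  refine ⟨L ++ L', fun χ hχ => (List.mem_append.1 hχ).elim (hL χ) (hL' χ),
    .mp (h.of_tautological_consequence fun v htop hneg hand hv => ?_) h'⟩
  simp only [imp_eq_true hneg hand, conjV_eq_true htop hand, List.mem_append] at hv ⊢
  exact fun h₁ h₂ => hv (fun χ hχ => h₂ χ (.inl hχ)) (h₁ fun χ hχ => h₂ χ (.inr hχ))

theorem ProvFromV.deduction {Γ : Set FormV} {φ ψ : FormV} (h : ProvFromV (insert φ Γ) ψ) :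
    ProvFromV Γ (.imp φ ψ) := by
  classical
  obtain ⟨L, hL, h⟩ := h
  refine ⟨L.filter (· ≠ φ), fun χ hχ => ?_,
    h.of_tautological_consequence fun v htop hneg hand hv => ?_⟩
  · simp only [List.mem_filter, decide_eq_true_eq] at hχ
    exact (hL χ hχ.1).resolve_left hχ.2
  · simp only [imp_eq_true hneg hand, conjV_eq_true htop hand, List.mem_filter,
      decide_eq_true_eq] at hv ⊢
    intro h₁ h₂
    refine hv fun χ hχ => ?_
    by_cases e : χ = φ
    · rwa [e]
    · exact h₁ χ ⟨hχ, e⟩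

theorem ProvFromV.box {i : ℕ} {s : Set FormV} {φ : FormV}
    (h : ProvFromV {ψ | FormV.box i ψ ∈ s} φ) : ProvFromV s (.box i φ) := by
  obtain ⟨L, hL, h⟩ := h
  induction L generalizing φ with
  | nil =>
    exact .of_provV (.necK i (.mp h (.taut fun v htop _ _ => htop)))
  | cons a L ih =>
    have ha : ProvFromV s (.box i (.imp a φ)) := by
      refine ih (fun ψ hψ => hL ψ (List.mem_cons_of_mem _ hψ))
        (h.of_tautological_consequence fun v htop hneg hand hv => ?_)
      simp only [imp_eq_true hneg hand, conjV_eq_true htop hand, List.forall_mem_cons] at hv ⊢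
      exact fun h₁ h₂ => hv ⟨h₂, h₁⟩
    exact ((ProvFromV.of_provV (.distK i a φ)).mp ha).mp (.of_mem (hL a List.mem_cons_self))

theorem ConsistentV.exists_MCSV {Γ : Set FormV} (h : ConsistentV Γ) :
    ∃ s, Γ ⊆ s ∧ MCSV s := by
  have hub : ∀ c ⊆ {s | ConsistentV s}, IsChain (· ⊆ ·) c → c.Nonempty →
      ∃ ub ∈ {s | ConsistentV s}, ∀ s ∈ c, s ⊆ ub := by
    refine fun c hc hchain hne => ⟨⋃₀ c, ?_, fun _ => Set.subset_sUnion_of_mem⟩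
    rintro ⟨L, hL, hp⟩
    obtain ⟨t, ht, hLt⟩ := DirectedOn.exists_mem_subset_of_finite_of_subset_sUnion hne
      hchain.directedOn L.finite_toSet hL
    exact hc ht ⟨L, hLt, hp⟩
  obtain ⟨s, hΓ, hs⟩ := zorn_subset_nonempty _ hub Γ h
  refine ⟨s, hΓ, hs.prop, fun φ hφ hcon => hφ ?_⟩
  exact hs.le_of_ge hcon (Set.subset_insert φ s) (Set.mem_insert φ s)

theorem MCSV.mem_of_provFromV {s : Set FormV} (hs : MCSV s) {φ : FormV}
    (h : ProvFromV s φ) : φ ∈ s := by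
  by_contra hφ
  exact hs.2 φ hφ fun hbot => hs.1 ((ProvFromV.deduction hbot).mp h)

theorem ConsistentV.insert_neg {Γ : Set FormV} {φ : FormV} (h : ¬ ProvFromV Γ φ) :
    ConsistentV (insert (.neg φ) Γ) := by
  intro hbot
  refine h ((ProvFromV.of_provV (.taut fun v htop hneg hand => ?_)).mp
    (ProvFromV.deduction hbot))
  rw [imp_eq_true hneg hand, imp_eq_true hneg hand, hneg, hneg, htop]
  cases v φ <;> simp

theorem MCSV.neg_mem_iff {s : Set FormV} (hs : MCSV s) {φ : FormV} :
    .neg φ ∈ s ↔ φ ∉ s := by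
  constructor
  · intro hn hφ
    refine hs.1 (((ProvFromV.of_provV (.taut fun v htop hneg hand => ?_)).mp
      (.of_mem hn)).mp (ProvFromV.of_mem hφ))
    rw [imp_eq_true hneg hand, imp_eq_true hneg hand, hneg]
    cases v φ <;> simp
  · intro hφ
    by_contra hn
    exact hs.2 _ hn (.insert_neg fun h => hφ (hs.mem_of_provFromV h))

theorem MCSV.and_mem_iff {s : Set FormV} (hs : MCSV s) {φ ψ : FormV} :
    .and φ ψ ∈ s ↔ φ ∈ s ∧ ψ ∈ s := by
  refine ⟨fun h => ⟨?_, ?_⟩, fun ⟨h₁, h₂⟩ => ?_⟩ <;> refine hs.mem_of_provFromV ?_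
  · refine (ProvFromV.of_provV (.taut fun v _ hneg hand => ?_)).mp (.of_mem h)
    simp +contextual [imp_eq_true hneg hand, hand]
  · refine (ProvFromV.of_provV (.taut fun v _ hneg hand => ?_)).mp (.of_mem h)
    simp +contextual [imp_eq_true hneg hand, hand]
  · refine ((ProvFromV.of_provV (.taut fun v _ hneg hand => ?_)).mp (.of_mem h₁)).mp (.of_mem h₂)
    simp +contextual [imp_eq_true hneg hand, hand]

theorem MCSV.exists_canRelV_of_box_notMem {s : Set FormV} (hs : MCSV s) {i : ℕ} {φ : FormV}
    (h : .box i φ ∉ s) : ∃ t, MCSV t ∧ canRelV i s t ∧ φ ∉ t := by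
  obtain ⟨t, hsub, ht⟩ := (ConsistentV.insert_neg (Γ := {ψ | FormV.box i ψ ∈ s}) (φ := φ)
    fun hp => h (hs.mem_of_provFromV hp.box)).exists_MCSV
  exact ⟨t, ht, fun ψ hψ => hsub (Set.mem_insert_of_mem _ hψ),
    ht.neg_mem_iff.1 (hsub (Set.mem_insert _ _))⟩

theorem MCSV.exists_canRelV_of_diactop_mem {s : Set FormV} (hs : MCSV s) {i c : ℕ}
    (h : FormV.diactop i c ∈ s) : ∃ t, MCSV t ∧ canRelV i s t := by
  have hdia : FormV.dia i .top ∈ s :=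
    hs.mem_of_provFromV ((ProvFromV.of_provV (.inclT i c)).mp (.of_mem h))
  obtain ⟨t, ht, hst, -⟩ := hs.exists_canRelV_of_box_notMem (hs.neg_mem_iff.1 hdia)
  exact ⟨t, ht, hst⟩

theorem satV_canModelV_iff (φ : FormV) (s : canModelV.S) : satV canModelV s φ ↔ φ ∈ s.val := by
  induction φ generalizing s with
  | top =>
    exact iff_of_true trivial
      (s.2.mem_of_provFromV (.of_provV (.taut fun v htop _ _ => htop)))
  | atom p => exact Iff.rfl
  | neg φ ih => rw [satV, ih, s.2.neg_mem_iff]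
  | and φ ψ ih₁ ih₂ => rw [satV, ih₁, ih₂, s.2.and_mem_iff]
  | box i φ ih =>
    refine ⟨fun h => ?_, fun h t hst => (ih t).2 (hst φ h)⟩
    by_contra hn
    obtain ⟨t, ht, hst, hφ⟩ := s.2.exists_canRelV_of_box_notMem hn
    exact hφ ((ih ⟨t, ht⟩).1 (h ⟨t, ht⟩ hst))
  | kvbot i c =>
    refine ⟨fun h => ?_, fun h t u hr => s.2.neg_mem_iff.1 hr.2.2 h⟩
    by_contra hn
    have hd : FormV.diactop i c ∈ s.val := s.2.neg_mem_iff.2 hn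
    obtain ⟨t, ht, hst⟩ := s.2.exists_canRelV_of_diactop_mem hd
    exact h ⟨t, ht⟩ ⟨t, ht⟩ ⟨hst, hst, hd⟩

theorem canModelV_isMLKv : canModelV.IsMLKv :=
  ⟨fun _ _ _ _ _ => and_left_comm, fun _ _ _ _ _ h => ⟨h.1, h.2.1⟩,
    fun _ _ _ _ _ _ h hv => .inl ⟨h.1, hv, h.2.2⟩⟩

/-- the canonical model of SMLKV is an MLKv^r model, and SMLKV is strongly
complete w.r.t. the class of all MLKv^r models: every SMLKV-consistent set of MLKv
formulas is satisfiable at some state of some MLKv^r model. -/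
theorem stmt19 :
    canModelV.IsMLKv ∧
    (∀ Γ : Set FormV, ConsistentV Γ →
      ∃ M : KFrame, M.IsMLKv ∧ ∃ s : M.S, ∀ φ ∈ Γ, satV M s φ) := by
  refine ⟨canModelV_isMLKv, fun Γ hΓ => ?_⟩
  obtain ⟨s, hsub, hs⟩ := hΓ.exists_MCSV
  exact ⟨canModelV, canModelV_isMLKv, ⟨s, hs⟩,
    fun φ hφ => (satV_canModelV_iff φ ⟨s, hs⟩).2 (hsub hφ)⟩
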